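/- Let F be a finite-dimensional semisimple ℚ-algebra, let M be a finitely generated (left) F-module, and let L be a ℤ-lattice in M. Let G be the group of all F-module automorphisms σ of M such that σ(L) = L. Then the set of F-submodules of M, equipped with the natural G-action (σ acting by N ↦ σ(N)), has only finitely many orbits. -/

import Mathlib

lemma unif_fin {W : Type*} [AddCommGroup W] (T : Submodule ℤ W) {ι : Type*} [Finite ι]
    (x : ι → W) (h : ∀ i, ∃ n : ℕ, 0 < n ∧ n • x i ∈ T) :
    ∃ n : ℕ, 0 < n ∧ ∀ i, n • x i ∈ T := by
  classical
  have := Fintype.ofFinite ι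
  choose n hn hT using h
  refine ⟨∏ i, n i, Finset.prod_pos fun i _ => hn i, fun i => ?_⟩
  rw [← Finset.prod_erase_mul _ _ (Finset.mem_univ i), mul_smul]
  exact T.nsmul_mem (hT i) _

lemma unif_fg {V W : Type*} [AddCommGroup V] [AddCommGroup W] (P : Submodule ℤ V) (hP : P.FG)
    (f : V →+ W) (T : Submodule ℤ W) (h : ∀ x ∈ P, ∃ n : ℕ, 0 < n ∧ n • f x ∈ T) :
    ∃ n : ℕ, 0 < n ∧ ∀ x ∈ P, n • f x ∈ T := by
  obtain ⟨s, rfl⟩ := hP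
  obtain ⟨n, hn, H⟩ := unif_fin T (fun i : s => f i) (fun i => h i (Submodule.subset_span i.2))
  refine ⟨n, hn, fun x hx => ?_⟩
  induction hx using Submodule.span_induction with
  | mem x hx => exact H ⟨x, hx⟩
  | zero => simp
  | add x y _ _ hx hy => rw [map_add, smul_add]; exact T.add_mem hx hy
  | smul a x _ hx => rw [map_zsmul, smul_comm]; exact T.smul_mem _ hx

def IsLat {V : Type*} [AddCommGroup V] (T : Submodule ℤ V) : Prop :=
  T.FG ∧ ∀ x, ∃ n : ℕ, 0 < n ∧ n • x ∈ T

lemma pigeon {ι : Type*} [Fintype ι] (Q : ℕ) (hQ : 0 < Q) (y : ι → ℚ) :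
    ∃ k : ℕ, 0 < k ∧ k ≤ Q ^ Fintype.card ι ∧ ∃ z : ι → ℤ, ∀ i, |k * y i - z i| < 1 / Q := by
  classical
  have hQ' : (0 : ℚ) < Q := by exact_mod_cast hQ
  have hfl : ∀ t : ℚ, ⌊Int.fract t * Q⌋₊ < Q := fun t => by
    rw [Nat.floor_lt (by have := Int.fract_nonneg t; positivity)]
    have := Int.fract_lt_one t
    nlinarith
  let f : Fin (Q ^ Fintype.card ι + 1) → (ι → Fin Q) := fun k i =>
    ⟨⌊Int.fract (k * y i) * Q⌋₊, hfl _⟩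
  have key : ∀ a b : Fin (Q ^ Fintype.card ι + 1), a < b → f a = f b →
      ∃ k : ℕ, 0 < k ∧ k ≤ Q ^ Fintype.card ι ∧ ∃ z : ι → ℤ, ∀ i, |k * y i - z i| < 1 / Q := by
    intro a b hab hf
    refine ⟨b - a, by have : (a : ℕ) < b := hab; omega, by omega,
      fun i => ⌊b * y i⌋ - ⌊a * y i⌋, fun i => ?_⟩
    have h1 : ⌊Int.fract (a * y i) * Q⌋₊ = ⌊Int.fract (b * y i) * Q⌋₊ := by
      have := congrFun hf i
      simpa [f] using this
    have ha := Nat.floor_le (a := Int.fract ((a : ℕ) * y i) * Q)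
      (by have := Int.fract_nonneg (((a : ℕ) : ℚ) * y i); positivity)
    have hb := Nat.floor_le (a := Int.fract ((b : ℕ) * y i) * Q)
      (by have := Int.fract_nonneg (((b : ℕ) : ℚ) * y i); positivity)
    have ha' := Nat.lt_floor_add_one (Int.fract (((a : ℕ) : ℚ) * y i) * Q)
    have hb' := Nat.lt_floor_add_one (Int.fract (((b : ℕ) : ℚ) * y i) * Q)
    rw [h1] at ha ha'
    rw [lt_div_iff₀ hQ', Nat.cast_sub hab.le]
    have e0 : ∀ t : ℚ, |t| * Q = |t * Q| := fun t => by rw [abs_mul, abs_of_pos hQ']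
    rw [e0, abs_lt]
    have e : (((b : ℕ) : ℚ) - (a : ℕ)) * y i - ((⌊((b : ℕ) : ℚ) * y i⌋ - ⌊((a : ℕ) : ℚ) * y i⌋ : ℤ) : ℚ)
      = Int.fract (((b : ℕ) : ℚ) * y i) - Int.fract (((a : ℕ) : ℚ) * y i) := by
      simp only [Int.fract]; push_cast; ring
    rw [e, sub_mul]
    constructor <;> linarith
  obtain ⟨a, b, hne, hf⟩ := Fintype.exists_ne_map_eq_of_card_lt f (by simp)
  rcases lt_or_gt_of_ne hne with h | h
  · exact key a b h hf
  · exact key b a h hf.symm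

lemma det_small {S : Type*} [AddCommGroup S] [Module ℚ S] [FiniteDimensional ℚ S] [Nontrivial S]
    {ι : Type*} [Fintype ι] (A : ι → Module.End ℚ S) :
    ∃ Q : ℕ, 0 < Q ∧ ∀ x : ι → ℚ, (∀ i, |x i| < 1 / Q) → |LinearMap.det (∑ i, x i • A i)| < 1 := by
  classical
  let b := Module.finBasis ℚ S
  have : Nonempty (Fin (Module.finrank ℚ S)) := ⟨⟨0, Module.finrank_pos⟩⟩
  have e : ∀ x : ι → ℚ, LinearMap.det (∑ i, x i • A i) =
      (∑ i, x i • LinearMap.toMatrix b b (A i)).det := by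
    intro x
    rw [← LinearMap.det_toMatrix b]
    simp
  have hc : Continuous fun x : ι → ℚ => |LinearMap.det (∑ i, x i • A i)| := by
    simp_rw [e]
    refine continuous_abs.comp (Continuous.matrix_det ?_)
    fun_prop
  have h0 : |LinearMap.det (∑ i, (0 : ι → ℚ) i • A i)| < 1 := by
    rw [e]; simp [Matrix.det_zero]
  obtain ⟨ε, hε, H⟩ := Metric.eventually_nhds_iff.1 (hc.continuousAt.eventually_lt_const h0)
  obtain ⟨n, hn⟩ := exists_nat_one_div_lt hε
  refine ⟨n + 1, n.succ_pos, fun x hx => H ?_⟩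
  rw [dist_pi_lt_iff hε]
  intro i
  rw [Pi.zero_apply, Rat.dist_eq]
  have h1 : (((1 : ℚ) / (n + 1 : ℕ) : ℚ) : ℝ) < ε := by push_cast; exact hn
  have h2 : ((|x i| : ℚ) : ℝ) < (((1 : ℚ) / (n + 1 : ℕ) : ℚ) : ℝ) := by exact_mod_cast hx i
  push_cast at h2 h1 ⊢
  simp
  linarith

lemma finite_between {V : Type*} [AddCommGroup V] [Module ℚ V] (L₀ : Submodule ℤ V) (h : L₀.FG)
    (K : ℕ) (hK : 0 < K) :
    {X : Submodule ℤ V | L₀ ≤ X ∧ ∀ x ∈ X, K • x ∈ L₀}.Finite := by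
  have : Module.Finite ℤ L₀ := Module.Finite.iff_fg.2 h
  have : IsAddTorsionFree V := .of_module_rat V
  let R : Submodule ℤ L₀ := LinearMap.range ((K : ℤ) • (LinearMap.id : L₀ →ₗ[ℤ] L₀))
  have : Finite (L₀ ⧸ R) := by
    apply Module.finite_of_fg_torsion
    intro x
    refine ⟨⟨(K : ℤ), by simpa using hK.ne'⟩, ?_⟩
    obtain ⟨x, rfl⟩ := Submodule.Quotient.mk_surjective R x
    change (K : ℤ) • (Submodule.Quotient.mk x : L₀ ⧸ R) = 0
    rw [← Submodule.Quotient.mk_smul, Submodule.Quotient.mk_eq_zero]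
    exact ⟨x, by simp⟩
  let Φ : Submodule ℤ V → Set (L₀ ⧸ R) := fun X =>
    {q | ∃ x ∈ X, ∃ hx : K • x ∈ L₀, q = Submodule.Quotient.mk ⟨K • x, hx⟩}
  have main : ∀ X Y : Submodule ℤ V, (∀ x ∈ X, K • x ∈ L₀) → L₀ ≤ Y → Φ X = Φ Y → X ≤ Y := by
    intro X Y hX hY e x hx
    have : (Submodule.Quotient.mk ⟨K • x, hX x hx⟩ : L₀ ⧸ R) ∈ Φ Y := by
      rw [← e]; exact ⟨x, hx, hX x hx, rfl⟩
    obtain ⟨y, hy, hy', e⟩ := this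
    rw [Submodule.Quotient.eq] at e
    obtain ⟨l, hl⟩ := e
    have hl := congrArg Subtype.val hl
    simp at hl
    have : x = y + l := by
      rw [← smul_sub] at hl
      have h2 : (l : V) = x - y := nsmul_right_injective hK.ne' hl
      rw [h2]; abel
    rw [this]
    exact Y.add_mem hy (hY l.2)
  refine Set.Finite.of_finite_image (f := Φ) (Set.toFinite _) ?_
  intro X hX Y hY e
  exact le_antisymm (main X Y hX.2 hY.1 e) (main Y X hY.2 hX.1 e.symm)

def JZ {F : Type*} [Ring F] (Λ : Submodule ℤ F) (M : Type*) [AddCommGroup M] [Module F M] : Prop :=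
  ∃ L₀ : Submodule ℤ M, IsLat L₀ ∧ ∃ K : ℕ, 0 < K ∧ ∀ T : Submodule ℤ M, IsLat T →
    (∀ a ∈ Λ, ∀ t ∈ T, a • t ∈ T) →
    ∃ g : M ≃ₗ[F] M, (∀ x ∈ L₀, g x ∈ T) ∧ ∀ t ∈ T, ∃ x ∈ L₀, K • t = g x

lemma density {F : Type*} [Ring F] [Algebra ℚ F]
    (S : Type*) [AddCommGroup S] [Module ℚ S] [Module F S] [IsScalarTower ℚ F S]
    [FiniteDimensional ℚ S] [IsSimpleModule F S] :
    ∃ (n : ℕ) (b : Fin n → F) (s : Fin n → S) (d : S → Fin n → Module.End F S),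
      (∀ i, s i ≠ 0) ∧ ∀ t, t = ∑ i, d t i (s i) ∧ ∀ i, b i • t = d t i (s i) := by
  classical
  have : Module.Finite (Module.End F S) S := Module.Finite.of_restrictScalars_finite ℚ _ S
  let B := Module.finBasis (Module.End F S) S
  have hsurj := Module.Finite.toModuleEnd_moduleEnd_surjective (R := F) (M := S)
  choose b hb using fun i => hsurj ((LinearMap.toSpanSingleton (Module.End F S) S (B i)) ∘ₗ B.coord i)
  refine ⟨_, b, B, fun t i => B.repr t i, fun i => B.ne_zero i, fun t => ⟨?_, fun i => ?_⟩⟩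
  · exact (B.sum_repr t).symm
  · have := LinearMap.congr_fun (hb i) t
    simpa using! this

lemma det_int {S : Type*} [AddCommGroup S] [Module ℚ S] {ι : Type*} [Fintype ι] [DecidableEq ι]
    (b : Module.Basis ι ℚ S) (f : Module.End ℚ S)
    (hf : ∀ x ∈ Submodule.span ℤ (Set.range b), f x ∈ Submodule.span ℤ (Set.range b)) :
    ∃ z : ℤ, LinearMap.det f = z := by
  have h : ∀ i j, ∃ z : ℤ, LinearMap.toMatrix b b f i j = z := by
    intro i j
    have h1 := hf (b j) (Submodule.subset_span ⟨j, rfl⟩)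
    rw [Module.Basis.mem_span_iff_repr_mem] at h1
    obtain ⟨z, hz⟩ := h1 i
    refine ⟨z, ?_⟩
    rw [LinearMap.toMatrix_apply, ← hz]; rfl
  choose Z hZ using h
  refine ⟨(Matrix.of Z).det, ?_⟩
  rw [← LinearMap.det_toMatrix b]
  have : LinearMap.toMatrix b b f = (Int.castRingHom ℚ).mapMatrix (Matrix.of Z) := by
    ext i j; simp [hZ]
  rw [this, ← RingHom.map_det]; rfl

lemma isLat_span_basis {S : Type*} [AddCommGroup S] [Module ℚ S] {ι : Type*} [Finite ι]
    (b : Module.Basis ι ℚ S) : IsLat (Submodule.span ℤ (Set.range b)) := by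
  classical
  have := Fintype.ofFinite ι
  refine ⟨Submodule.fg_span (Set.finite_range b), fun x => ?_⟩
  have h := unif_fin (Submodule.span ℤ (Set.range b)) (fun i => b.repr x i • b i) (fun i => by
    refine ⟨(b.repr x i).den, (b.repr x i).den_pos, ?_⟩
    rw [← Nat.cast_smul_eq_nsmul ℚ, smul_smul, Rat.den_mul_eq_num, Int.cast_smul_eq_zsmul]
    exact Submodule.smul_mem _ _ (Submodule.subset_span ⟨i, rfl⟩))
  obtain ⟨n, hn, h⟩ := h
  refine ⟨n, hn, ?_⟩
  rw [← b.sum_repr x, Finset.smul_sum]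
  exact Submodule.sum_mem _ fun i _ => h i

lemma approx {F : Type*} [Ring F] [Algebra ℚ F]
    {S : Type*} [AddCommGroup S] [Module ℚ S] [Module F S] [IsScalarTower ℚ F S]
    [FiniteDimensional ℚ S] [Nontrivial S] (S₀ : Submodule ℤ S) (hS₀ : IsLat S₀) :
    ∃ C : ℕ, ∀ δ : Module.End F S, ∃ k : ℕ, 0 < k ∧ k ≤ C ∧ ∃ l : Module.End F S,
      (∀ x ∈ S₀, l x ∈ S₀) ∧ |LinearMap.det ((k • δ - l).restrictScalars ℚ)| < 1 := by
  classical
  let ρ : Module.End F S →ₗ[ℚ] Module.End ℚ S := LinearMap.restrictScalarsₗ ℚ F S S ℚ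
  have : FiniteDimensional ℚ (Module.End F S) :=
    FiniteDimensional.of_injective ρ (LinearMap.restrictScalars_injective ℚ)
  let e := Module.finBasis ℚ (Module.End F S)
  have hn : ∀ i, ∃ n : ℕ, 0 < n ∧ ∀ x ∈ S₀, n • e i x ∈ S₀ := fun i =>
    unif_fg S₀ hS₀.1 (e i).toAddMonoidHom S₀ (fun x _ => hS₀.2 _)
  choose n hn hS using hn
  obtain ⟨Q, hQ, hdet⟩ := det_small (fun i => ρ (n i • e i))
  refine ⟨Q ^ Fintype.card (Fin (Module.finrank ℚ (Module.End F S))), fun δ => ?_⟩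
  obtain ⟨k, hk, hkC, z, hz⟩ := pigeon Q hQ (fun i => e.repr δ i / n i)
  refine ⟨k, hk, hkC, ∑ i, z i • (n i • e i), fun x hx => ?_, ?_⟩
  · simp only [LinearMap.sum_apply, LinearMap.smul_apply]
    exact Submodule.sum_mem _ fun i _ => Submodule.smul_mem _ _ (hS i x hx)
  · have := hdet _ hz
    convert this using 3
    change ρ _ = _
    simp_rw [← map_smul]
    rw [← map_sum]
    congr 1
    simp_rw [sub_smul]
    rw [Finset.sum_sub_distrib]
    congr 1
    · conv_lhs => rw [← e.sum_repr δ]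
      rw [Finset.smul_sum]
      refine Finset.sum_congr rfl fun i _ => ?_
      rw [← Nat.cast_smul_eq_nsmul ℚ (n i), smul_smul, ← Nat.cast_smul_eq_nsmul ℚ k, smul_smul]
      congr 1
      have : (n i : ℚ) ≠ 0 := by exact_mod_cast (hn i).ne'
      field_simp
    · refine Finset.sum_congr rfl fun i _ => ?_
      rw [Int.cast_smul_eq_zsmul]

lemma jz_simple {F : Type*} [Ring F] [Algebra ℚ F] (Λ : Submodule ℤ F)
    (hΛ : ∀ a : F, ∃ n : ℕ, 0 < n ∧ n • a ∈ Λ)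
    (S : Type*) [AddCommGroup S] [Module ℚ S] [Module F S] [IsScalarTower ℚ F S]
    [FiniteDimensional ℚ S] [IsSimpleModule F S] : JZ Λ S := by
  classical
  have : Nontrivial S := IsSimpleModule.nontrivial F S
  have tf : IsAddTorsionFree S := .of_module_rat S
  let b := Module.finBasis ℚ S
  let S₀ := Submodule.span ℤ (Set.range b)
  have hS₀ : IsLat S₀ := isLat_span_basis b
  obtain ⟨C, hC⟩ := approx (F := F) S₀ hS₀
  obtain ⟨n, β, s, d, hs, hd⟩ := density (F := F) S
  -- a multiple of `s i` lies in `S₀`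
  obtain ⟨m₂, hm₂, hsS⟩ := unif_fin S₀ s (fun i => hS₀.2 _)
  -- uniform denominators
  have hf : ∀ i j, ∃ f : F, f • s i = b j := fun i j =>
    IsSimpleModule.toSpanSingleton_surjective F (hs i) (b j)
  choose f hf using hf
  choose ν hν hνΛ using fun i j => hΛ (f i j * β i)
  let m₁ := ∏ i, ∏ j, ν i j
  have hm₁ : 0 < m₁ := Finset.prod_pos fun i _ => Finset.prod_pos fun j _ => hν i j
  have hm₁Λ : ∀ i j, m₁ • (f i j * β i) ∈ Λ := by
    intro i j
    have : ν i j ∣ m₁ := (Finset.dvd_prod_of_mem (ν i) (Finset.mem_univ j)).trans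
      (Finset.dvd_prod_of_mem (fun i => ∏ j, ν i j) (Finset.mem_univ i))
    obtain ⟨c, hc⟩ := this
    rw [hc, mul_comm, mul_smul]
    exact Λ.nsmul_mem (hνΛ i j) _
  refine ⟨S₀, hS₀, C.factorial * m₁ * m₂, by have := C.factorial_pos; positivity, ?_⟩
  intro T hT hTΛ
  -- the set `I` of homs
  have hI : ∀ t ∈ T, ∀ i, ∀ x ∈ S₀, (m₁ • d t i) x ∈ T := by
    intro t ht i x hx
    induction hx using Submodule.span_induction with
    | mem x hx =>
      obtain ⟨j, rfl⟩ := hx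
      rw [LinearMap.smul_apply, ← hf i j, map_smul, ← (hd t).2 i, smul_smul, ← smul_assoc]
      exact hTΛ _ (hm₁Λ i j) t ht
    | zero => simp
    | add x y _ _ hx hy => rw [map_add]; exact T.add_mem hx hy
    | smul a x _ hx => rw [map_zsmul]; exact T.smul_mem _ hx
  -- minimal element
  obtain ⟨q, hq, hqT⟩ := unif_fg T hT.1 (AddMonoidHom.id S) S₀ (fun x _ => hS₀.2 _)
  let N : Module.End F S → ℚ := fun d => |LinearMap.det (d.restrictScalars ℚ)|
  have hNz : ∀ d : Module.End F S, (∀ x ∈ S₀, d x ∈ T) →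
      ∃ z : ℕ, (q : ℚ) ^ Module.finrank ℚ S * N d = z := by
    intro d hd
    obtain ⟨z, hz⟩ := det_int b ((q : ℚ) • d.restrictScalars ℚ) (fun x hx => by
      have := hqT _ (hd x hx)
      rw [LinearMap.smul_apply, Nat.cast_smul_eq_nsmul]
      exact this)
    refine ⟨z.natAbs, ?_⟩
    rw [LinearMap.det_smul] at hz
    rw [Nat.cast_natAbs, Int.cast_abs, ← hz, abs_mul, abs_of_nonneg (by positivity)]
  have hex : ∃ z : ℕ, ∃ d : Module.End F S, d ≠ 0 ∧ (∀ x ∈ S₀, d x ∈ T) ∧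
      (q : ℚ) ^ Module.finrank ℚ S * N d = z := by
    obtain ⟨x, hx⟩ := exists_ne (0 : S)
    obtain ⟨r, hr, hrT⟩ := hT.2 x
    have hne : r • x ≠ 0 := by simpa [hr.ne'] using hx
    have : ∃ i, d (r • x) i ≠ 0 := by
      by_contra! h
      apply hne
      rw [(hd (r • x)).1]
      exact Finset.sum_eq_zero fun i _ => by rw [h i]; rfl
    obtain ⟨i, hi⟩ := this
    obtain ⟨z, hz⟩ := hNz (m₁ • d (r • x) i) (hI _ hrT i)
    refine ⟨z, _, ?_, hI _ hrT i, hz⟩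
    intro h0
    apply hi
    ext y
    have := LinearMap.congr_fun h0 y
    simpa [hm₁.ne'] using this
  obtain ⟨D, hD0, hDT, hDz⟩ := Nat.find_spec hex
  have hmin : ∀ d : Module.End F S, (∀ x ∈ S₀, d x ∈ T) → N d < N D → d = 0 := by
    intro d hdT hlt
    by_contra h0
    obtain ⟨z, hz⟩ := hNz d hdT
    have h1 := Nat.find_min' hex ⟨d, h0, hdT, hz⟩
    have h2 : (Nat.find hex : ℚ) ≤ z := by exact_mod_cast h1
    rw [← hDz, ← hz] at h2
    have : (0 : ℚ) < (q : ℚ) ^ Module.finrank ℚ S := by positivity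
    nlinarith
  let g : S ≃ₗ[F] S := LinearEquiv.ofBijective D (LinearMap.bijective_of_ne_zero hD0)
  have hg : ∀ x, g x = D x := fun x => rfl
  have hgD : (g : S →ₗ[F] S) = D := rfl
  have hNpos : 0 < N D := by
    refine abs_pos.2 ?_
    have := (LinearEquiv.isUnit_det' (g.restrictScalars ℚ)).ne_zero
    exact this
  -- every element of `I` is nearly a multiple of `D`
  have hmul : ∀ d : Module.End F S, (∀ x ∈ S₀, d x ∈ T) →
      ∃ l : Module.End F S, (∀ x ∈ S₀, l x ∈ S₀) ∧ C.factorial • d = D * l := by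
    intro d hdT
    let δ : Module.End F S := g.symm.toLinearMap ∘ₗ d
    have hδ : D * δ = d := by
      ext x; change g (g.symm (d x)) = d x; simp
    obtain ⟨k, hk, hkC, l, hl, hlt⟩ := hC δ
    have hz : k • d - D * l = 0 := by
      apply hmin
      · intro x hx
        exact T.sub_mem (T.nsmul_mem (hdT x hx) k) (hDT _ (hl x hx))
      · have e : k • d - D * l = D * (k • δ - l) := by
          rw [mul_sub, mul_smul_comm, hδ]
        have e2 : N (D * (k • δ - l)) = N D * |LinearMap.det ((k • δ - l).restrictScalars ℚ)| := by
          change |LinearMap.det ((D.restrictScalars ℚ) ∘ₗ (k • δ - l).restrictScalars ℚ)| = _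
          rw [LinearMap.det_comp, abs_mul]
        rw [e, e2]
        nlinarith
    obtain ⟨c, hc⟩ := Nat.dvd_factorial hk hkC
    refine ⟨c • l, fun x hx => S₀.nsmul_mem (hl x hx) c, ?_⟩
    rw [hc, mul_comm, mul_smul, sub_eq_zero.1 hz, mul_smul_comm]
  refine ⟨g, hDT, fun t ht => ?_⟩
  choose l hl hlD using fun i => hmul _ (hI t ht i)
  refine ⟨∑ i, l i (m₂ • s i), Submodule.sum_mem _ fun i _ => hl i _ (hsS i), ?_⟩
  rw [map_sum]
  conv_lhs => rw [(hd t).1, Finset.smul_sum]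
  refine Finset.sum_congr rfl fun i _ => ?_
  have := LinearMap.congr_fun (hlD i) (m₂ • s i)
  rw [hg]
  change _ = (D * l i) (m₂ • s i)
  rw [← this]
  simp only [LinearMap.smul_apply, map_nsmul, smul_smul]
  congr 1
  ring

lemma IsLat.prod {A B : Type*} [AddCommGroup A] [AddCommGroup B] {P : Submodule ℤ A}
    {Q : Submodule ℤ B} (hP : IsLat P) (hQ : IsLat Q) : IsLat (P.prod Q) := by
  refine ⟨hP.1.prod hQ.1, fun x => ?_⟩
  obtain ⟨n, hn, h⟩ := hP.2 x.1
  obtain ⟨m, hm, h'⟩ := hQ.2 x.2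
  refine ⟨n * m, by positivity, ?_, ?_⟩
  · change (n * m) • x.1 ∈ P
    rw [mul_comm, mul_smul]; exact P.nsmul_mem h _
  · change (n * m) • x.2 ∈ Q
    rw [mul_smul]; exact Q.nsmul_mem h' _

lemma jz_prod {F : Type*} [Ring F] [Algebra ℚ F] (Λ : Submodule ℤ F)
    (hΛ : ∀ a : F, ∃ n : ℕ, 0 < n ∧ n • a ∈ Λ)
    (A B : Type*) [AddCommGroup A] [Module ℚ A] [Module F A] [IsScalarTower ℚ F A]
    [FiniteDimensional ℚ A]
    [AddCommGroup B] [Module ℚ B] [Module F B] [IsScalarTower ℚ F B]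
    [FiniteDimensional ℚ B] [Module.Projective F B] (hA : JZ Λ A) (hB : JZ Λ B) :
    ∃ L₀ : Submodule ℤ (A × B), IsLat L₀ ∧ ∃ K : ℕ, 0 < K ∧ ∀ T : Submodule ℤ (A × B), IsLat T →
    (∀ a ∈ Λ, ∀ t ∈ T, a • t ∈ T) →
    ∃ g : (A × B) ≃ₗ[F] (A × B), (∀ x ∈ L₀, g x ∈ T) ∧ (∀ t ∈ T, ∃ x ∈ L₀, K • t = g x) ∧
      ∀ x, (g x).2 = 0 ↔ x.2 = 0 := by
  obtain ⟨PA, hPA, K₁, hK₁, HA⟩ := hA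
  obtain ⟨PB, hPB, K₂, hK₂, HB⟩ := hB
  have tfB : IsAddTorsionFree B := .of_module_rat B
  have : Module.Finite F B := Module.Finite.of_restrictScalars_finite ℚ F B
  obtain ⟨n, p, hp⟩ := Module.Finite.exists_fin' F B
  obtain ⟨i, hi⟩ := Module.projective_lifting_property p LinearMap.id hp
  have hpi : ∀ b, p (i b) = b := fun b => LinearMap.congr_fun hi b
  obtain ⟨m, hm, hmΛ⟩ := unif_fg PB hPB.1 i.toAddMonoidHom
    (Submodule.pi Set.univ fun _ => Λ) (fun x _ => by
      obtain ⟨N, hN, h⟩ := unif_fin Λ (i x) (fun j => hΛ _)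
      exact ⟨N, hN, fun j _ => h j⟩)
  obtain ⟨m', hm', hmB⟩ := unif_fin PB (fun j => p (Pi.single j 1)) (fun j => hPB.2 _)
  refine ⟨PA.prod PB, hPA.prod hPB, K₁ * (m * m' * K₂), by positivity, ?_⟩
  intro T hT hTΛ
  obtain ⟨g₁, hg₁, hg₁'⟩ := HA (T.comap (LinearMap.inl ℤ A B)) (by
    refine ⟨?_, fun x => ?_⟩
    · refine Submodule.fg_of_fg_map_injective (LinearMap.inl ℤ A B) LinearMap.inl_injective ?_
      exact Submodule.FG.of_le hT.1 (Submodule.map_comap_le _ _)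
    · obtain ⟨n, hn, h⟩ := hT.2 (x, 0)
      refine ⟨n, hn, ?_⟩
      simpa using h) (by
    intro a ha t ht
    have := hTΛ a ha _ ht
    simpa using this)
  obtain ⟨g₂, hg₂, hg₂'⟩ := HB (T.map (LinearMap.snd ℤ A B)) (by
    refine ⟨hT.1.map _, fun x => ?_⟩
    obtain ⟨n, hn, h⟩ := hT.2 (0, x)
    exact ⟨n, hn, ⟨_, h, by simp⟩⟩) (by
    rintro a ha _ ⟨t, ht, rfl⟩
    exact ⟨_, hTΛ a ha _ ht, by simp⟩)
  choose y hyT hy using fun j => hg₂ _ (hmB j)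
  let φ : (Fin n → F) →ₗ[F] A × B := Fintype.linearCombination F y
  have hφ : ∀ v, φ v = ∑ j, v j • y j := fun v => by
    simp [φ, Fintype.linearCombination_apply]
  have hφ2 : ∀ v, (φ v).2 = m' • g₂ (p v) := by
    have : LinearMap.snd F A B ∘ₗ φ = m' • (g₂.toLinearMap ∘ₗ p) := by
      refine LinearMap.pi_ext' fun j => LinearMap.ext_ring ?_
      simp only [LinearMap.comp_apply, LinearMap.smul_apply, LinearMap.coe_single]
      rw [hφ]
      have h3 : ∑ k, (Pi.single j (1 : F) : Fin n → F) k • y k = y j := by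
        rw [Finset.sum_eq_single j]
        · simp
        · intro k _ hk; simp [Pi.single_eq_of_ne hk]
        · simp
      rw [h3]
      have := hy j
      simp only [LinearMap.snd_apply] at this ⊢
      rw [this, map_nsmul]; rfl
    intro v
    exact LinearMap.congr_fun this v
  let h : B →ₗ[F] A × B := φ ∘ₗ (m • i)
  have hhT : ∀ b ∈ PB, h b ∈ T := by
    intro b hb
    change φ (m • i b) ∈ T
    rw [hφ]
    refine Submodule.sum_mem _ fun j _ => hTΛ _ ?_ _ (hyT j)
    exact hmΛ b hb j trivial
  have hh2 : ∀ b, (h b).2 = (m * m') • g₂ b := by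
    intro b
    change (φ (m • i b)).2 = _
    rw [hφ2, map_nsmul, hpi, map_nsmul, smul_smul, mul_comm]
  let g : (A × B) →ₗ[F] (A × B) := LinearMap.coprod (LinearMap.inl F A B ∘ₗ g₁.toLinearMap) h
  have hg : ∀ x, g x = (g₁ x.1, 0) + h x.2 := fun x => by simp [g]
  have hg2 : ∀ x, (g x).2 = (m * m') • g₂ x.2 := fun x => by rw [hg, Prod.snd_add, hh2]; simp
  have hg20 : ∀ x, (g x).2 = 0 ↔ x.2 = 0 := fun x => by
    rw [hg2]
    simp [hm.ne', hm'.ne']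
  have hinj : Function.Injective g := by
    rw [injective_iff_map_eq_zero]
    intro x hx
    have h2 : x.2 = 0 := (hg20 x).1 (by rw [hx]; rfl)
    have h1 := hg x
    rw [hx, h2, map_zero, add_zero] at h1
    have h1 := congrArg Prod.fst h1
    simp at h1
    exact Prod.ext (g₁.map_eq_zero_iff.1 h1.symm) h2
  have hsurj : Function.Surjective g :=
    (LinearMap.injective_iff_surjective (f := g.restrictScalars ℚ)).1 hinj
  refine ⟨LinearEquiv.ofBijective g ⟨hinj, hsurj⟩, ?_, ?_, hg20⟩
  · rintro x ⟨hx1, hx2⟩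
    change g x ∈ T
    rw [hg]
    exact T.add_mem (hg₁ _ hx1) (hhT _ hx2)
  · intro t ht
    obtain ⟨b, hb, hbe⟩ := hg₂' t.2 ⟨t, ht, rfl⟩
    have h0 : ((m * m' * K₂) • t - h b).2 = 0 := by
      rw [Prod.snd_sub, hh2, ← hbe, Prod.smul_snd, smul_smul, sub_self]
    obtain ⟨a, ha, hae⟩ := hg₁' ((m * m' * K₂) • t - h b).1 (by
      change (((m * m' * K₂) • t - h b).1, (0 : B)) ∈ T
      rw [← h0]
      exact T.sub_mem (T.nsmul_mem ht _) (hhT b hb))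
    refine ⟨(a, K₁ • b), ⟨ha, PB.nsmul_mem hb _⟩, ?_⟩
    change _ = g _
    rw [hg, ← hae, map_nsmul, mul_smul]
    have : (K₁ • ((m * m' * K₂) • t - h b).1, (0 : B)) = K₁ • ((m * m' * K₂) • t - h b) :=
      Prod.ext rfl (by rw [Prod.smul_snd, h0, smul_zero])
    rw [this, smul_sub]
    abel

lemma IsLat.comap_equiv {A B : Type*} [AddCommGroup A] [AddCommGroup B] {T : Submodule ℤ B}
    (hT : IsLat T) (e : A ≃ₗ[ℤ] B) : IsLat (T.comap e.toLinearMap) := by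
  refine ⟨?_, fun x => ?_⟩
  · refine Submodule.fg_of_fg_map_injective e.toLinearMap e.injective ?_
    exact Submodule.FG.of_le hT.1 (Submodule.map_comap_le _ _)
  · obtain ⟨n, hn, h⟩ := hT.2 (e x)
    refine ⟨n, hn, ?_⟩
    simpa using h

lemma JZ.congr {F : Type*} [Ring F] {Λ : Submodule ℤ F} {A B : Type*} [AddCommGroup A]
    [AddCommGroup B] [Module F A] [Module F B] (e : A ≃ₗ[F] B) (h : JZ Λ A) : JZ Λ B := by
  obtain ⟨L₀, hL₀, K, hK, H⟩ := h
  let e' : A ≃ₗ[ℤ] B := e.toAddEquiv.toIntLinearEquiv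
  have he' : ∀ x, e' x = e x := fun _ => rfl
  have he's : ∀ x, e'.symm x = e.symm x := fun _ => rfl
  refine ⟨L₀.comap e'.symm.toLinearMap, hL₀.comap_equiv _, K, hK, fun T hT hTΛ => ?_⟩
  obtain ⟨g, hg, hg'⟩ := H (T.comap e'.toLinearMap) (hT.comap_equiv _) (fun a ha t ht => by
    have := hTΛ a ha _ ht
    simpa [he'] using this)
  refine ⟨(e.symm.trans g).trans e, fun x hx => hg _ hx, fun t ht => ?_⟩
  obtain ⟨x, hx, hxe⟩ := hg' (e.symm t) (by simpa [he'] using ht)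
  refine ⟨e x, by simpa [he's] using hx, ?_⟩
  simp [← hxe]

theorem jz_all {F : Type*} [Ring F] [Algebra ℚ F] [IsSemisimpleRing F] (Λ : Submodule ℤ F)
    (hΛ : ∀ a : F, ∃ n : ℕ, 0 < n ∧ n • a ∈ Λ) (d : ℕ) :
    ∀ (M : Type*) [AddCommGroup M] [Module ℚ M] [Module F M] [IsScalarTower ℚ F M]
    [FiniteDimensional ℚ M], Module.finrank ℚ M = d → JZ Λ M := by
  induction d using Nat.strong_induction_on with
  | _ d ih =>
  intro M _ _ _ _ _ hd
  by_cases hS : IsSimpleModule F M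
  · exact jz_simple Λ hΛ M
  by_cases hN : Nontrivial M
  · have : ∃ N : Submodule F M, N ≠ ⊥ ∧ N ≠ ⊤ := by
      by_contra! h
      have : IsSimpleOrder (Submodule F M) := ⟨fun N => or_iff_not_imp_left.2 (h N)⟩
      exact hS ⟨⟩
    obtain ⟨N, hN0, hN1⟩ := this
    obtain ⟨N', hc⟩ := exists_isCompl N
    have h1 : Module.finrank ℚ N < d := by
      rw [← hd]
      exact Submodule.finrank_lt (s := N.restrictScalars ℚ)
        (by rwa [Ne, Submodule.restrictScalars_eq_top_iff])
    have h2 : Module.finrank ℚ N' < d := by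
      rw [← hd]
      refine Submodule.finrank_lt (s := N'.restrictScalars ℚ) ?_
      rw [Ne, Submodule.restrictScalars_eq_top_iff]
      rintro rfl
      exact hN0 (by simpa using hc.disjoint)
    have f1 : FiniteDimensional ℚ N :=
      inferInstanceAs (FiniteDimensional ℚ (N.restrictScalars ℚ))
    have f2 : FiniteDimensional ℚ N' :=
      inferInstanceAs (FiniteDimensional ℚ (N'.restrictScalars ℚ))
    have j1 := ih _ h1 N rfl
    have j2 := ih _ h2 N' rfl
    have := Module.projective_of_isSemisimpleRing F N'
    obtain ⟨L₀, hL₀, K, hK, H⟩ := jz_prod Λ hΛ N N' j1 j2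
    refine JZ.congr (Submodule.prodEquivOfIsCompl N N' hc) ⟨L₀, hL₀, K, hK, fun T hT hTΛ => ?_⟩
    obtain ⟨g, h1, h2, -⟩ := H T hT hTΛ
    exact ⟨g, h1, h2⟩
  · rw [not_nontrivial_iff_subsingleton] at hN
    refine ⟨⊥, ⟨Submodule.fg_bot, fun x => ⟨1, one_pos, by simp [Subsingleton.elim x 0]⟩⟩, 1,
      one_pos, fun T _ _ => ⟨LinearEquiv.refl F M, fun x _ => ?_, fun t _ => ⟨0, by simp,
        Subsingleton.elim _ _⟩⟩⟩
    rw [Subsingleton.elim (LinearEquiv.refl F M x) 0]; exact T.zero_mem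

lemma fin_types {F : Type*} [Ring F] {M : Type*} [AddCommGroup M] [Module F M]
    [IsSemisimpleModule F M] [Module.Finite F M] :
    ∃ 𝒬 : Finset (Submodule F M), ∀ N : Submodule F M, ∃ Q ∈ 𝒬, IsCompl N Q := by
  classical
  obtain ⟨s, hind, hsup, hs⟩ := IsSemisimpleModule.exists_sSupIndep_sSup_simples_eq_top F M
  have hfin : s.Finite := WellFoundedGT.finite_of_sSupIndep hind
  have hfin' : {J : Set (Submodule F M) | J ⊆ s}.Finite := hfin.finite_subsets
  refine ⟨hfin'.toFinset.image sSup, fun N => ?_⟩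
  have hfin2 : {J : Set (Submodule F M) | J ⊆ s ∧ Disjoint N (sSup J)}.Finite :=
    hfin'.subset fun J hJ => hJ.1
  obtain ⟨J, hJ⟩ := hfin2.exists_maximal ⟨∅, by simp⟩
  have hJs := hJ.prop.1
  have hJd := hJ.prop.2
  refine ⟨sSup J, ?_, hJd, ?_⟩
  · simp only [Finset.mem_image, Set.Finite.mem_toFinset]
    exact ⟨J, hJs, rfl⟩
  · rw [codisjoint_iff, eq_top_iff, ← hsup]
    refine sSup_le fun a ha => ?_
    have := hs a ha
    have hat : IsAtom a := isSimpleModule_iff_isAtom.1 this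
    by_contra hle
    have hdis : Disjoint (N ⊔ sSup J) a := (hat.not_le_iff_disjoint.1 hle).symm
    have h2 : Disjoint N (sSup J ⊔ a) := Disjoint.disjoint_sup_right_of_disjoint_sup_left hJd hdis
    have h3 : insert a J ∈ {J : Set (Submodule F M) | J ⊆ s ∧ Disjoint N (sSup J)} :=
      ⟨Set.insert_subset ha hJs, by rwa [sSup_insert, sup_comm]⟩
    have h4 := hJ.le_of_ge h3 (Set.subset_insert a J)
    exact hle ((le_sSup (h4 (Set.mem_insert a J))).trans le_sup_right)

lemma fin_orbits {F : Type*} [Ring F] [Algebra ℚ F] [IsSemisimpleRing F]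
    {M : Type*} [AddCommGroup M] [Module ℚ M] [Module F M] [IsScalarTower ℚ F M]
    [FiniteDimensional ℚ M] (Λ : Submodule ℤ F)
    (hΛ : ∀ a : F, ∃ n : ℕ, 0 < n ∧ n • a ∈ Λ)
    (L : Submodule ℤ M) (hL : IsLat L) (hLΛ : ∀ a ∈ Λ, ∀ t ∈ L, a • t ∈ L) (A B : Submodule F M) :
    ∃ S : Finset (Submodule F M), ∀ N : Submodule F M,
      (∃ e : (A × B) ≃ₗ[F] M, ∀ x, e x ∈ N ↔ x.2 = 0) →
      ∃ σ : M ≃ₗ[F] M, (∀ x, σ x ∈ L ↔ x ∈ L) ∧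
        ∃ N₀ ∈ S, ∀ x, σ x ∈ N ↔ x ∈ N₀ := by
  classical
  have f1 : FiniteDimensional ℚ A := inferInstanceAs (FiniteDimensional ℚ (A.restrictScalars ℚ))
  have f2 : FiniteDimensional ℚ B := inferInstanceAs (FiniteDimensional ℚ (B.restrictScalars ℚ))
  have := Module.projective_of_isSemisimpleRing F B
  obtain ⟨L₀, hL₀, K, hK, H⟩ := jz_prod Λ hΛ A B (jz_all Λ hΛ _ A rfl) (jz_all Λ hΛ _ B rfl)
  have hfin := finite_between L₀ hL₀.1 K hK
  let P : Submodule F M → Submodule ℤ (A × B) → Prop := fun N X =>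
    ∃ τ : (A × B) ≃ₗ[F] M, (∀ x, τ x ∈ L ↔ x ∈ X) ∧ ∀ x, τ x ∈ N ↔ x.2 = 0
  let c : Submodule ℤ (A × B) → Submodule F M := fun X =>
    if h : ∃ N, P N X then h.choose else ⊥
  have hc : ∀ X N, P N X → P (c X) X := fun X N h => by
    have h' : ∃ N, P N X := ⟨N, h⟩
    simp only [c, dif_pos h']
    exact h'.choose_spec
  refine ⟨hfin.toFinset.image c, fun N ⟨e, he⟩ => ?_⟩
  let e' : (A × B) ≃ₗ[ℤ] M := e.toAddEquiv.toIntLinearEquiv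
  have he' : ∀ x, e' x = e x := fun _ => rfl
  obtain ⟨g, hg1, hg2, hg3⟩ := H (L.comap e'.toLinearMap) (hL.comap_equiv _) (fun a ha t ht => by
    have := hLΛ a ha _ ht
    simpa [he'] using! this)
  let g' : (A × B) ≃ₗ[ℤ] (A × B) := g.toAddEquiv.toIntLinearEquiv
  let X : Submodule ℤ (A × B) := (L.comap e'.toLinearMap).comap g'.toLinearMap
  have hX : ∀ x, e (g x) ∈ L ↔ x ∈ X := fun x => Iff.rfl
  have hPN : P N X := ⟨g.trans e, hX, fun x => (he (g x)).trans (hg3 x)⟩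
  have hPN' := hPN
  obtain ⟨τ, hτ1, hτ2⟩ := hPN'
  obtain ⟨τ', hτ1', hτ2'⟩ := hc X N hPN
  refine ⟨τ'.symm.trans τ, fun x => ?_, c X, ?_, fun x => ?_⟩
  · rw [LinearEquiv.trans_apply, hτ1, ← hτ1', LinearEquiv.apply_symm_apply]
  · refine Finset.mem_image_of_mem c ?_
    rw [Set.Finite.mem_toFinset]
    refine ⟨fun x hx => hg1 x hx, fun x hx => ?_⟩
    obtain ⟨y, hy, hye⟩ := hg2 (g x) hx
    rw [← map_nsmul] at hye
    rw [g.injective hye]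
    exact hy
  · rw [LinearEquiv.trans_apply, hτ2, ← hτ2', LinearEquiv.apply_symm_apply]

/-- **Proposition 7.1.** Let `F` be a finite-dimensional semisimple `ℚ`-algebra, `M` a
finitely generated `F`-module, and `L` a `ℤ`-lattice in `M`. Let `G` be the group of
`F`-module automorphisms `σ` of `M` with `σ(L) = L`. Then the set of `F`-submodules of `M`
has finitely many orbits under the natural action of `G`: there is a finite set `S` of
`F`-submodules such that every `F`-submodule of `M` is of the form `σ(N)` for some
`N ∈ S` and some `σ ∈ G`. -/
theorem finitely_many_orbits_of_submodules
    (F : Type*) [Ring F] [Algebra ℚ F] [FiniteDimensional ℚ F] [IsSemisimpleRing F]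
    (M : Type*) [AddCommGroup M] [Module ℚ M] [Module F M] [IsScalarTower ℚ F M]
    [Module.Finite F M]
    (L : AddSubgroup M) (hLfg : L.FG)
    (hLspan : Submodule.span ℚ (L : Set M) = ⊤) :
    ∃ S : Finset (Submodule F M), ∀ N : Submodule F M,
      ∃ σ : M ≃ₗ[F] M, L.map σ.toLinearMap.toAddMonoidHom = L ∧
        ∃ N₀ ∈ S, Submodule.map (σ : M →ₗ[F] M) N₀ = N := by
  classical
  have : FiniteDimensional ℚ M := Module.Finite.trans F M
  let L' : Submodule ℤ M := AddSubgroup.toIntSubmodule L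
  have hLL' : ∀ x, x ∈ L' ↔ x ∈ L := fun _ => Iff.rfl
  have hL' : IsLat L' := by
    refine ⟨(Submodule.fg_iff_addSubgroup_fg L').2 (by simpa [L'] using hLfg), fun x => ?_⟩
    have hx : x ∈ Submodule.span ℚ (L : Set M) := hLspan ▸ Submodule.mem_top
    induction hx using Submodule.span_induction with
    | mem x hx => exact ⟨1, one_pos, by rw [one_smul]; exact hx⟩
    | zero => exact ⟨1, one_pos, by simp⟩
    | add x y _ _ hx hy =>
      obtain ⟨n, hn, h⟩ := hx
      obtain ⟨m, hm, h'⟩ := hy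
      refine ⟨n * m, by positivity, ?_⟩
      rw [smul_add]
      refine L'.add_mem ?_ ?_
      · rw [mul_comm, mul_smul]; exact L'.nsmul_mem h _
      · rw [mul_smul]; exact L'.nsmul_mem h' _
    | smul a x _ hx =>
      obtain ⟨n, hn, h⟩ := hx
      refine ⟨n * a.den, Nat.mul_pos hn a.den_pos, ?_⟩
      have : (n * a.den) • a • x = a.num • (n • x) := by
        rw [mul_smul, ← Nat.cast_smul_eq_nsmul ℚ a.den, smul_smul, Rat.den_mul_eq_num,
          Int.cast_smul_eq_zsmul, smul_comm]
      rw [this]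
      exact L'.smul_mem _ h
  let Λ : Submodule ℤ F :=
    { carrier := {a | ∀ l ∈ L', a • l ∈ L'}
      add_mem' := fun {a b} ha hb l hl => by rw [add_smul]; exact L'.add_mem (ha l hl) (hb l hl)
      zero_mem' := fun l _ => by rw [zero_smul]; exact L'.zero_mem
      smul_mem' := fun n a ha l hl => by rw [smul_assoc]; exact L'.smul_mem n (ha l hl) }
  have hΛ : ∀ a : F, ∃ n : ℕ, 0 < n ∧ n • a ∈ Λ := by
    intro a
    obtain ⟨n, hn, h⟩ := unif_fg L' hL'.1 (DistribSMul.toAddMonoidHom M a) L'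
      (fun x _ => hL'.2 _)
    refine ⟨n, hn, fun l hl => ?_⟩
    rw [smul_assoc]
    exact h l hl
  choose S hS using fun A B => fin_orbits Λ hΛ L' hL' (fun a ha t ht => ha t ht) A B
  obtain ⟨𝒬, h𝒬⟩ := fin_types (F := F) (M := M)
  refine ⟨𝒬.biUnion fun A => 𝒬.biUnion fun B => S A B, fun N => ?_⟩
  obtain ⟨N', hc⟩ := exists_isCompl N
  obtain ⟨A, hA, hcA⟩ := h𝒬 N'
  obtain ⟨B, hB, hcB⟩ := h𝒬 N
  -- `N ≃ M ⧸ N' ≃ A` and `N' ≃ M ⧸ N ≃ B`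
  let eA : A ≃ₗ[F] N := (Submodule.quotientEquivOfIsCompl N' A hcA).symm.trans
    (Submodule.quotientEquivOfIsCompl N' N hc.symm)
  let eB : B ≃ₗ[F] N' := (Submodule.quotientEquivOfIsCompl N B hcB).symm.trans
    (Submodule.quotientEquivOfIsCompl N N' hc)
  let e : (A × B) ≃ₗ[F] M := (LinearEquiv.prodCongr eA eB).trans
    (Submodule.prodEquivOfIsCompl N N' hc)
  have he : ∀ x, e x ∈ N ↔ x.2 = 0 := by
    intro x
    have : e x = (eA x.1 : M) + (eB x.2 : M) := by
      simp [e]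
    rw [this, Submodule.add_mem_iff_right _ (eA x.1).2]
    constructor
    · intro h
      have := Submodule.disjoint_def.1 hc.disjoint _ h (eB x.2).2
      simpa using this
    · intro h
      simp [h]
  obtain ⟨σ, hσL, N₀, hN₀, hσN⟩ := hS A B N ⟨e, he⟩
  refine ⟨σ, ?_, N₀, ?_, ?_⟩
  · ext x
    constructor
    · rintro ⟨y, hy, rfl⟩
      exact (hσL y).2 hy
    · intro hx
      refine ⟨σ.symm x, ?_, σ.apply_symm_apply x⟩
      have := hσL (σ.symm x)
      rw [σ.apply_symm_apply] at this
      exact this.1 hx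
  · simp only [Finset.mem_biUnion]
    exact ⟨A, hA, B, hB, hN₀⟩
  · ext x
    constructor
    · rintro ⟨y, hy, rfl⟩
      exact (hσN y).2 hy
    · intro hx
      refine ⟨σ.symm x, ?_, σ.apply_symm_apply x⟩
      have := hσN (σ.symm x)
      rw [σ.apply_symm_apply] at this
      exact this.1 hx
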